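/- Let n ≥ 1, let a ∈ ℝ, let h > 0, α > 0 and c₁ > 0 be real numbers, let W : ℝⁿ → ℝ be continuously differentiable, and let v : ℝⁿ → ℂ be twice continuously differentiable with compact support. Assume that ∂_{x_n}W(x) ≤ -c₁ for every x in the support of v with x_n ≥ a, and that v satisfies the conjugated equation (-h²Δ + W + 2hα ∂_{x_n})v = 0 on the open half-space {x ∈ ℝⁿ : x_n > a}. Then c₁ ∫_{{x_n > a}} |v(x)|² dx ≤ h² ∫_{{x_n = a}} |∇_{x'}v(x',a)|² dx' + ∫_{{x_n = a}} max(W(x',a), 0) |v(x',a)|² dx', where x = (x', x_n) ∈ ℝⁿ⁻¹ × ℝ, ∇_{x'} denotes the gradient in the first n-1 variables, the integral over {x_n > a} is with respect to Lebesgue measure on ℝⁿ, and the integrals over {x_n = a} are with respect to Lebesgue measure on ℝⁿ⁻¹. -/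

import Mathlib

open MeasureTheory

/-- Partial derivative in the last coordinate, for functions on ℝⁿ ≅ ℝ^k × ℝ. -/
noncomputable def pdLast {k : ℕ} (v : (Fin k → ℝ) × ℝ → ℂ) (x : (Fin k → ℝ) × ℝ) : ℂ :=
  fderiv ℝ v x (0, 1)

/-- Partial derivative in the `i`-th tangential coordinate. -/
noncomputable def pdTang {k : ℕ} (i : Fin k) (v : (Fin k → ℝ) × ℝ → ℂ)
    (x : (Fin k → ℝ) × ℝ) : ℂ :=
  fderiv ℝ v x (Pi.single i 1, 0)

/-- Laplacian on ℝⁿ ≅ ℝ^k × ℝ. -/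
noncomputable def lap {k : ℕ} (v : (Fin k → ℝ) × ℝ → ℂ) (x : (Fin k → ℝ) × ℝ) : ℂ :=
  (∑ i : Fin k,
      fderiv ℝ (fun y => fderiv ℝ v y (Pi.single i 1, 0)) x (Pi.single i 1, 0))
    + fderiv ℝ (fun y => fderiv ℝ v y (0, 1)) x (0, 1)

open scoped RealInnerProductSpace

theorem HasCompactSupport.comp_prodMk_left {X Y M : Type*} [TopologicalSpace X]
    [TopologicalSpace Y] [R1Space Y] [Zero M] {f : X × Y → M} (hf : HasCompactSupport f) (x : X) :
    HasCompactSupport fun y => f (x, y) :=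
  .intro (hf.isCompact.image continuous_snd) fun y hy =>
    image_eq_zero_of_notMem_tsupport fun h => hy ⟨(x, y), h, rfl⟩

theorem HasCompactSupport.comp_prodMk_right {X Y M : Type*} [TopologicalSpace X]
    [TopologicalSpace Y] [R1Space X] [Zero M] {f : X × Y → M} (hf : HasCompactSupport f) (y : Y) :
    HasCompactSupport fun x => f (x, y) :=
  .intro (hf.isCompact.image continuous_fst) fun x hx =>
    image_eq_zero_of_notMem_tsupport fun h => hx ⟨(x, y), h, rfl⟩

theorem HasCompactSupport.norm_sq {X F : Type*} [TopologicalSpace X] [NormedAddCommGroup F]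
    {f : X → F} (hf : HasCompactSupport f) : HasCompactSupport fun x => ‖f x‖ ^ 2 :=
  hf.comp_left (g := fun z => ‖z‖ ^ 2) (by simp)

theorem HasCompactSupport.inner_right {X F : Type*} [TopologicalSpace X] [NormedAddCommGroup F]
    [InnerProductSpace ℝ F] {f g : X → F} (hg : HasCompactSupport g) :
    HasCompactSupport fun x => ⟪f x, g x⟫ :=
  hg.mono fun x hx h => hx (by simp [h])

section HalfSpace

variable {E : Type*} [NormedAddCommGroup E] [NormedSpace ℝ E]

theorem volume_restrict_snd_gt {E : Type*} [MeasureSpace E] [SFinite (volume : Measure E)]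
    (a : ℝ) :
    (volume : Measure (E × ℝ)).restrict {x | a < x.2} =
      (volume : Measure E).prod (volume.restrict (Set.Ioi a)) := by
  have : {x : E × ℝ | a < x.2} = Set.univ ×ˢ Set.Ioi a := by ext; simp
  rw [this, Measure.volume_eq_prod, ← Measure.prod_restrict, Measure.restrict_univ]

theorem integral_fderiv_apply_eq_zero [FiniteDimensional ℝ E] [MeasurableSpace E] [BorelSpace E]
    (μ : Measure E) [μ.IsAddHaarMeasure] {g : E → ℝ} (hg : ContDiff ℝ 1 g)
    (hgc : HasCompactSupport g) (u : E) : ∫ x, fderiv ℝ g x u ∂μ = 0 := by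
  have hg' : Continuous fun x => fderiv ℝ g x u :=
    (hg.continuous_fderiv one_ne_zero).clm_apply continuous_const
  simpa using integral_mul_fderiv_eq_neg_fderiv_mul_of_integrable (μ := μ) (v := u)
    (f := fun _ => (1 : ℝ)) (g := g) (by simp)
    (by simpa using hg'.integrable_of_hasCompactSupport (hgc.fderiv_apply (𝕜 := ℝ) u))
    (by simpa using hg.continuous.integrable_of_hasCompactSupport hgc)
    (fun x _ => differentiableAt_const _) fun x _ => hg.differentiable one_ne_zero x

variable [MeasureSpace E] [BorelSpace E]
  [(volume : Measure E).IsAddHaarMeasure] {g : E × ℝ → ℝ}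

theorem integrableOn_fderiv_apply (hg : ContDiff ℝ 1 g) (hgc : HasCompactSupport g)
    (u : E × ℝ) (s : Set (E × ℝ)) : IntegrableOn (fun x => fderiv ℝ g x u) s :=
  (((hg.continuous_fderiv one_ne_zero).clm_apply
    continuous_const).integrable_of_hasCompactSupport (hgc.fderiv_apply (𝕜 := ℝ) u)).integrableOn

variable [FiniteDimensional ℝ E]

theorem setIntegral_halfSpace_fderiv_normal (hg : ContDiff ℝ 1 g) (hgc : HasCompactSupport g)
    (a : ℝ) : ∫ x in {x : E × ℝ | a < x.2}, fderiv ℝ g x (0, 1) = -∫ x', g (x', a) := by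
  have hi := integrableOn_fderiv_apply hg hgc (0, 1) {x | a < x.2}
  rw [IntegrableOn, volume_restrict_snd_gt] at hi
  rw [volume_restrict_snd_gt, integral_prod _ hi, ← integral_neg]
  congr 1 with x'
  have hslice := (hgc.comp_prodMk_left x').integral_Ioi_deriv_eq
    (hg.comp (contDiff_const.prodMk contDiff_id)) a
  refine Eq.trans ?_ hslice
  congr 1 with t
  exact ((hg.differentiable one_ne_zero (x', t)).hasFDerivAt.comp_hasDerivAt t
    ((hasDerivAt_const t x').prodMk (hasDerivAt_id t))).deriv.symm

theorem setIntegral_halfSpace_fderiv_tangential (hg : ContDiff ℝ 1 g) (hgc : HasCompactSupport g)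
    (a : ℝ) (u : E) : ∫ x in {x : E × ℝ | a < x.2}, fderiv ℝ g x (u, 0) = 0 := by
  have hi := integrableOn_fderiv_apply hg hgc (u, 0) {x | a < x.2}
  rw [IntegrableOn, volume_restrict_snd_gt] at hi
  rw [volume_restrict_snd_gt, integral_prod_symm _ hi]
  refine integral_eq_zero_of_ae (.of_forall fun t => ?_)
  refine Eq.trans ?_ (integral_fderiv_apply_eq_zero volume
    (hg.comp (contDiff_id.prodMk contDiff_const)) (hgc.comp_prodMk_right t) u)
  refine integral_congr_ae (.of_forall fun x' => ?_)
  have hpair : HasFDerivAt (fun x : E => (x, t)) ((ContinuousLinearMap.id ℝ E).prod 0) x' :=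
    (hasFDerivAt_id x').prodMk (hasFDerivAt_const t x')
  have := (hg.differentiable one_ne_zero (x', t)).hasFDerivAt.comp x' hpair
  exact (congrArg (fun L : E →L[ℝ] ℝ => L u) this.fderiv).symm

end HalfSpace

section Identities

variable {E F : Type*} [NormedAddCommGroup E] [NormedSpace ℝ E] [NormedAddCommGroup F]
  [InnerProductSpace ℝ F]

theorem fderiv_norm_sq_real_apply {f : E → F} {x : E} (hf : DifferentiableAt ℝ f x) (u : E) :
    fderiv ℝ (fun y => ‖f y‖ ^ 2) x u = 2 * ⟪f x, fderiv ℝ f x u⟫ := by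
  rw [hf.hasFDerivAt.norm_sq.fderiv]
  simp

theorem ContDiff.fderiv_apply_const {v : E → F} (hv : ContDiff ℝ 2 v) (u : E) :
    ContDiff ℝ 1 fun y => fderiv ℝ v y u :=
  (hv.fderiv_right (by norm_num)).clm_apply contDiff_const

theorem fderiv_fderiv_apply_comm {v : E → F} (hv : ContDiff ℝ 2 v) (x u w : E) :
    fderiv ℝ (fun y => fderiv ℝ v y u) x w = fderiv ℝ (fun y => fderiv ℝ v y w) x u := by
  have hd : DifferentiableAt ℝ (fderiv ℝ v) x :=
    (hv.fderiv_right (m := 1) (by norm_num)).differentiable one_ne_zero x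
  have key (u w : E) : fderiv ℝ (fun y => fderiv ℝ v y u) x w = fderiv ℝ (fderiv ℝ v) x w u := by
    rw [fderiv_clm_apply hd (differentiableAt_const u)]
    simp
  rw [key, key]
  exact hv.contDiffAt.isSymmSndFDerivAt (by simp) w u

/-- The Rellich identity in a pair of directions `u`, `e`. -/
theorem two_mul_inner_fderiv_fderiv_apply {v : E → F} (hv : ContDiff ℝ 2 v) (x u e : E) :
    2 * ⟪fderiv ℝ (fun y => fderiv ℝ v y u) x u, fderiv ℝ v x e⟫ =
      2 * fderiv ℝ (fun y => ⟪fderiv ℝ v y u, fderiv ℝ v y e⟫) x u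
        - fderiv ℝ (fun y => ‖fderiv ℝ v y u‖ ^ 2) x e := by
  have hd (w : E) : DifferentiableAt ℝ (fun y => fderiv ℝ v y w) x :=
    (hv.fderiv_apply_const w).differentiable one_ne_zero x
  rw [fderiv_norm_sq_real_apply (hd u), fderiv_inner_apply ℝ (hd u) (hd e),
    fderiv_fderiv_apply_comm hv x u e]
  ring

end Identities

/-- Carleman-type L² lower bound (heart of Proposition 6.1): if `v` is a
compactly supported solution of the conjugated equation
`(-h²Δ + W + 2hα ∂ₙ)v = 0` on `{xₙ > a}` and `∂ₙ W ≤ -c₁` on the support of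
`v` in `{xₙ ≥ a}`, then
`c₁ ∫_{xₙ>a} |v|² ≤ h² ∫_{xₙ=a} |∇' v|² dx' + ∫_{xₙ=a} max(W,0) |v|² dx'`. -/
theorem stmt0 {k : ℕ} (a h α c₁ : ℝ) (hh : 0 < h) (hα : 0 < α) (hc₁ : 0 < c₁)
    (W : (Fin k → ℝ) × ℝ → ℝ) (hW : ContDiff ℝ 1 W)
    (v : (Fin k → ℝ) × ℝ → ℂ) (hv : ContDiff ℝ 2 v) (hvc : HasCompactSupport v)
    (hWdec : ∀ x ∈ tsupport v, a ≤ x.2 → fderiv ℝ W x (0, 1) ≤ -c₁)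
    (heq : ∀ x : (Fin k → ℝ) × ℝ, a < x.2 →
      -(h ^ 2 : ℂ) * lap v x + (W x : ℂ) * v x + (2 * h * α : ℂ) * pdLast v x = 0) :
    c₁ * (∫ x in {x : (Fin k → ℝ) × ℝ | a < x.2}, ‖v x‖ ^ 2)
      ≤ h ^ 2 * (∫ x' : Fin k → ℝ, ∑ i : Fin k, ‖pdTang i v (x', a)‖ ^ 2)
        + (∫ x' : Fin k → ℝ, max (W (x', a)) 0 * ‖v (x', a)‖ ^ 2) := by
  set e : (Fin k → ℝ) × ℝ := (0, 1) with he
  set b : Fin k → (Fin k → ℝ) × ℝ := fun i => (Pi.single i 1, 0)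
  set S : Set ((Fin k → ℝ) × ℝ) := {x | a < x.2}
  have hD := hv.fderiv_apply_const
  have hDc (u) : HasCompactSupport fun y => fderiv ℝ v y u := hvc.fderiv_apply (𝕜 := ℝ) u
  set P : (Fin k → ℝ) × ℝ → (Fin k → ℝ) × ℝ → ℝ := fun u y => ‖fderiv ℝ v y u‖ ^ 2
  set G : Fin k → (Fin k → ℝ) × ℝ → ℝ := fun i y => ⟪fderiv ℝ v y (b i), fderiv ℝ v y e⟫
  set V : (Fin k → ℝ) × ℝ → ℝ := fun y => W y * ‖v y‖ ^ 2 with hV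
  have hPd (u) : ContDiff ℝ 1 (P u) := (hD u).norm_sq ℝ
  have hPc (u) : HasCompactSupport (P u) := (hDc u).norm_sq
  have hGd (i) : ContDiff ℝ 1 (G i) := (hD (b i)).inner ℝ (hD e)
  have hGc (i) : HasCompactSupport (G i) := (hDc e).inner_right
  have hv1 : ContDiff ℝ 1 v := hv.of_le (by norm_num)
  have hNd : ContDiff ℝ 1 fun y => ‖v y‖ ^ 2 := hv1.norm_sq ℝ
  have hNc : HasCompactSupport fun y => ‖v y‖ ^ 2 := hvc.norm_sq
  have hVd : ContDiff ℝ 1 V := hW.mul hNd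
  have hVc : HasCompactSupport V := hNc.mul_left
  have pointwise : ∀ x ∈ S, c₁ * ‖v x‖ ^ 2 ≤
      h ^ 2 * (∑ i, (2 * fderiv ℝ (G i) x (b i) - fderiv ℝ (P (b i)) x e) + fderiv ℝ (P e) x e)
        - fderiv ℝ V x e := by
    intro x hx
    have hlap : (h ^ 2) • lap v x = W x • v x + (2 * h * α) • fderiv ℝ v x e := by
      have := heq x hx
      simp only [pdLast, ← he] at this
      simp only [Complex.real_smul]
      push_cast
      linear_combination -this
    have hin : h ^ 2 * ⟪lap v x, fderiv ℝ v x e⟫ =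
        W x * ⟪v x, fderiv ℝ v x e⟫ + 2 * h * α * ‖fderiv ℝ v x e‖ ^ 2 := by
      rw [← real_inner_smul_left, hlap, inner_add_left, real_inner_smul_left,
        real_inner_smul_left, real_inner_self_eq_norm_sq]
    have hsum : 2 * ⟪lap v x, fderiv ℝ v x e⟫ =
        ∑ i, (2 * fderiv ℝ (G i) x (b i) - fderiv ℝ (P (b i)) x e) + fderiv ℝ (P e) x e := by
      rw [lap, inner_add_left, sum_inner, mul_add, Finset.mul_sum]
      congr 1
      · exact Finset.sum_congr rfl fun i _ => two_mul_inner_fderiv_fderiv_apply hv x (b i) e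
      · rw [fderiv_norm_sq_real_apply ((hD e).differentiable one_ne_zero x), real_inner_comm]
    have hVx : fderiv ℝ V x e =
        fderiv ℝ W x e * ‖v x‖ ^ 2 + 2 * (W x * ⟪v x, fderiv ℝ v x e⟫) := by
      rw [hV, fderiv_fun_mul (hW.differentiable one_ne_zero x) (hNd.differentiable one_ne_zero x)]
      simp only [add_apply, smul_apply, smul_eq_mul]
      rw [fderiv_norm_sq_real_apply (hv1.differentiable one_ne_zero x)]
      ring
    have hdec : c₁ * ‖v x‖ ^ 2 ≤ -fderiv ℝ W x e * ‖v x‖ ^ 2 := by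
      by_cases hxv : x ∈ tsupport v
      · have := hWdec x hxv (le_of_lt hx)
        gcongr
        linarith
      · simp [image_eq_zero_of_notMem_tsupport hxv]
    have hpos : 0 ≤ 4 * h * α * ‖fderiv ℝ v x e‖ ^ 2 := by positivity
    rw [← hsum, hVx]
    linarith
  have hint {g : (Fin k → ℝ) × ℝ → ℝ} (hg : ContDiff ℝ 1 g) (hgc : HasCompactSupport g) (u) :
      Integrable (fun x => fderiv ℝ g x u) (volume.restrict S) :=
    integrableOn_fderiv_apply hg hgc u S
  have hIi (i) : Integrable (fun x => 2 * fderiv ℝ (G i) x (b i) - fderiv ℝ (P (b i)) x e)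
      (volume.restrict S) :=
    ((hint (hGd i) (hGc i) (b i)).const_mul 2).sub (hint (hPd (b i)) (hPc (b i)) e)
  have hIs := integrable_finsetSum Finset.univ fun i _ => hIi i
  have hIe := hint (hPd e) (hPc e) e
  have hIse : Integrable (fun x => h ^ 2 * (∑ i, (2 * fderiv ℝ (G i) x (b i)
      - fderiv ℝ (P (b i)) x e) + fderiv ℝ (P e) x e)) (volume.restrict S) :=
    (hIs.add hIe).const_mul (h ^ 2)
  have hslice {g : (Fin k → ℝ) × ℝ → ℝ} (hg : Continuous g) (hgc : HasCompactSupport g) :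
      Integrable fun x' => g (x', a) :=
    (hg.comp (.prodMk_left a)).integrable_of_hasCompactSupport (hgc.comp_prodMk_right a)
  have hineq := setIntegral_mono_on
    ((hNd.continuous.integrable_of_hasCompactSupport hNc).integrableOn.const_mul c₁)
    (hIse.sub (hint hVd hVc e))
    (measurableSet_lt measurable_const measurable_snd) pointwise
  simp only [Pi.sub_apply] at hineq
  rw [integral_const_mul, integral_sub hIse (hint hVd hVc e),
    integral_const_mul, integral_add hIs hIe, integral_finsetSum _ fun i _ => hIi i,
    setIntegral_halfSpace_fderiv_normal (hPd e) (hPc e),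
    setIntegral_halfSpace_fderiv_normal hVd hVc] at hineq
  have htang (i) :
      ∫ x in S, (2 * fderiv ℝ (G i) x (b i) - fderiv ℝ (P (b i)) x e) = ∫ x', P (b i) (x', a) := by
    rw [integral_sub ((hint (hGd i) (hGc i) (b i)).const_mul 2) (hint (hPd (b i)) (hPc (b i)) e),
      integral_const_mul, setIntegral_halfSpace_fderiv_tangential (hGd i) (hGc i),
      setIntegral_halfSpace_fderiv_normal (hPd (b i)) (hPc (b i))]
    ring
  simp_rw [htang] at hineq
  rw [← integral_finsetSum _ fun i _ => hslice (hPd (b i)).continuous (hPc (b i))] at hineq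
  have hVle : ∫ x', V (x', a) ≤ ∫ x', max (W (x', a)) 0 * ‖v (x', a)‖ ^ 2 := by
    refine integral_mono (hslice hVd.continuous hVc) (hslice
      (g := fun x => max (W x) 0 * ‖v x‖ ^ 2)
      ((hW.continuous.max continuous_const).mul hNd.continuous) hNc.mul_left) fun x' => ?_
    exact mul_le_mul_of_nonneg_right (le_max_left _ _) (by positivity)
  have hPe : 0 ≤ h ^ 2 * ∫ x', P e (x', a) :=
    mul_nonneg (by positivity) (integral_nonneg fun x' => by positivity)
  simp only [pdTang]
  linarith
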